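/- Let P : C →_A C' be an execution step and let E be a weakly connected component of G(A_b). Then in C' the nodes of E still induce a weakly connected directed subgraph identical to E, and no leaf of E (i.e., no node of E having no child in E) belongs to B'. -/

import Mathlib

open scoped Classical

/-- A pre-configuration: a finite node set `V` with a partial parent map
(`none` means the node has no parent) and an integer height assignment. -/
structure PreConfig (V : Type*) where
  parent : V → Option V
  height : V → ℤ

namespace PreConfig

variable {V : Type*} [Fintype V] [LinearOrder V]

/-- The children of `u` are the nodes whose parent is `u`. -/
noncomputable def children (C : PreConfig V) (u : V) : Finset V :=
  Finset.univ.filter (fun v => C.parent v = some u)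

/-- A leaf is a node with no children. -/
def IsLeaf (C : PreConfig V) (u : V) : Prop := C.children u = ∅

/-- Maximum height value among the children of `u` (junk value `0` for a leaf). -/
noncomputable def maxH (C : PreConfig V) (u : V) : ℤ :=
  if h : (C.children u).Nonempty then (C.children u).sup' h C.height else 0

/-- Minimum height value among the children of `u` (junk value `0` for a leaf). -/
noncomputable def minH (C : PreConfig V) (u : V) : ℤ :=
  if h : (C.children u).Nonempty then (C.children u).inf' h C.height else 0

/-- A child of `u` of maximum height value; ties broken by a fixed rule
(smallest ID). Junk value `u` for a leaf. -/
noncomputable def maxChild (C : PreConfig V) (u : V) : V :=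
  if h : ((C.children u).filter fun v => C.height v = C.maxH u).Nonempty
  then ((C.children u).filter fun v => C.height v = C.maxH u).min' h else u

/-- A child of `u` of minimum height value; ties broken by a fixed rule
(smallest ID). Junk value `u` for a leaf. -/
noncomputable def minChild (C : PreConfig V) (u : V) : V :=
  if h : ((C.children u).filter fun v => C.height v = C.minH u).Nonempty
  then ((C.children u).filter fun v => C.height v = C.minH u).min' h else u

/-- `stable(u)`: `h(u) = 0` if `u` is a leaf, and `h(u) = 1 + max_{w child of u} h(w)` otherwise. -/
def Stable (C : PreConfig V) (u : V) : Prop :=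
  (C.IsLeaf u ∧ C.height u = 0) ∨ (¬ C.IsLeaf u ∧ C.height u = 1 + C.maxH u)

/-- `balanced(u)`: `|h(z) − h(z')| ≤ α` for all children `z, z'` of `u`. -/
def Balanced (α : ℤ) (C : PreConfig V) (u : V) : Prop :=
  ∀ z ∈ C.children u, ∀ z' ∈ C.children u, |C.height z - C.height z'| ≤ α

/-- `u` is enabled for a height update iff `¬stable(u)`. -/
def UpdateEnabled (C : PreConfig V) (u : V) : Prop := ¬ C.Stable u

/-- `u` is enabled for a swap iff `stable(u) ∧ stable(max(u)) ∧ ¬balanced(u)`. -/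
def SwapEnabled (α : ℤ) (C : PreConfig V) (u : V) : Prop :=
  C.Stable u ∧ C.Stable (C.maxChild u) ∧ ¬ Balanced α C u

/-- `u` is enabled iff it is enabled for a height update or for a swap. -/
def Enabled (α : ℤ) (C : PreConfig V) (u : V) : Prop :=
  C.UpdateEnabled u ∨ SwapEnabled α C u

/-- The value written by a height update: `0` for a leaf, `1 + max_{w child of u} h(w)` otherwise. -/
noncomputable def newHeight (C : PreConfig V) (u : V) : ℤ :=
  if C.IsLeaf u then 0 else 1 + C.maxH u

/-- A bad node: an internal node `u` with `h(u) ≤ max_{v child of u} h(v)`,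
or a leaf `u` with `h(u) < 0`. -/
def Bad (C : PreConfig V) (u : V) : Prop :=
  (¬ C.IsLeaf u ∧ C.height u ≤ C.maxH u) ∨ (C.IsLeaf u ∧ C.height u < 0)

/-- `v` reaches `a` by iterating the parent map. -/
def Reaches (C : PreConfig V) (v a : V) : Prop :=
  Relation.ReflTransGen (fun x y => C.parent x = some y) v a

/-- The underlying graph is a rooted tree with root `r`: `r` has no parent,
every other node has a (unique) parent, and every node reaches `r` by
iterating the parent map. -/
def IsTree (C : PreConfig V) (r : V) : Prop :=
  C.parent r = none ∧ (∀ v, C.parent v = none → v = r) ∧ ∀ v, C.Reaches v r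

/-- The subtree `S_u` of `u`: the set of descendants of `u` (including `u`). -/
def subtree (C : PreConfig V) (u : V) : Set V := {v | C.Reaches v u}

/-- The actual height `h*(u)` of `u`: the length of a longest directed path
going downward from `u` (such a maximal path necessarily ends at a leaf of `S_u`). -/
noncomputable def hstar (C : PreConfig V) (u : V) : ℕ :=
  sSup {n : ℕ | ∃ f : ℕ → V, f 0 = u ∧ ∀ i < n, C.parent (f (i + 1)) = some (f i)}

/-- An execution step `C →_A C'`: a nonempty set `A` of nodes enabled in `C` is
activated simultaneously; each `u ∈ A` enabled for a height update sets its height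
to `newHeight`; each `u ∈ A` enabled for a swap replaces the edges `(u, min(u))` and
`(max(u), max(max(u)))` by `(u, max(max(u)))` and `(max(u), min(u))` (all guards and
functions evaluated in `C`); everything else is unchanged. -/
structure Step (α : ℤ) (C C' : PreConfig V) (A : Finset V) : Prop where
  nonempty : A.Nonempty
  all_enabled : ∀ u ∈ A, Enabled α C u
  height_update : ∀ u ∈ A, C.UpdateEnabled u → C'.height u = C.newHeight u
  height_keep : ∀ u, ¬ (u ∈ A ∧ C.UpdateEnabled u) → C'.height u = C.height u
  swap_out : ∀ u ∈ A, SwapEnabled α C u → C'.parent (C.minChild u) = some (C.maxChild u)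
  swap_in : ∀ u ∈ A, SwapEnabled α C u → C'.parent (C.maxChild (C.maxChild u)) = some u
  parent_keep : ∀ v, (∀ u ∈ A, SwapEnabled α C u →
      v ≠ C.minChild u ∧ v ≠ C.maxChild (C.maxChild u)) → C'.parent v = C.parent v

end PreConfig

namespace PreConfig

section

variable {V : Type*} [Fintype V] [LinearOrder V] {α : ℤ} {C C' : PreConfig V} {A : Finset V}

theorem mem_children {u v : V} : v ∈ C.children u ↔ C.parent v = some u := by
  simp [children]

theorem height_le_maxH {u v : V} (h : v ∈ C.children u) : C.height v ≤ C.maxH u := by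
  have hne : (C.children u).Nonempty := ⟨v, h⟩
  rw [maxH, dif_pos hne]
  exact Finset.le_sup' _ h

theorem maxH_le {u : V} (hu : ¬ C.IsLeaf u) {a : ℤ} (h : ∀ v ∈ C.children u, C.height v ≤ a) :
    C.maxH u ≤ a := by
  have hne : (C.children u).Nonempty := Finset.nonempty_iff_ne_empty.mpr hu
  rw [maxH, dif_pos hne]
  exact Finset.sup'_le _ _ h

theorem maxChild_mem {u : V} (hu : ¬ C.IsLeaf u) : C.maxChild u ∈ C.children u := by
  have hne : (C.children u).Nonempty := Finset.nonempty_iff_ne_empty.mpr hu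
  have h : ((C.children u).filter fun v => C.height v = C.maxH u).Nonempty := by
    obtain ⟨v, hv, hv'⟩ := Finset.exists_mem_eq_sup' hne C.height
    exact ⟨v, Finset.mem_filter.mpr ⟨hv, by rw [maxH, dif_pos hne, hv']⟩⟩
  rw [maxChild, dif_pos h]
  exact (Finset.mem_filter.mp (Finset.min'_mem _ h)).1

theorem minChild_mem {u : V} (hu : ¬ C.IsLeaf u) : C.minChild u ∈ C.children u := by
  have hne : (C.children u).Nonempty := Finset.nonempty_iff_ne_empty.mpr hu
  have h : ((C.children u).filter fun v => C.height v = C.minH u).Nonempty := by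
    obtain ⟨v, hv, hv'⟩ := Finset.exists_mem_eq_inf' hne C.height
    exact ⟨v, Finset.mem_filter.mpr ⟨hv, by rw [minH, dif_pos hne, hv']⟩⟩
  rw [minChild, dif_pos h]
  exact (Finset.mem_filter.mp (Finset.min'_mem _ h)).1

theorem maxChild_of_isLeaf {u : V} (hu : C.IsLeaf u) : C.maxChild u = u := by
  rw [IsLeaf] at hu
  simp [maxChild, hu]

theorem SwapEnabled.not_isLeaf {u : V} (h : SwapEnabled α C u) : ¬ C.IsLeaf u := fun hl =>
  h.2.2 fun z hz => by
    rw [IsLeaf] at hl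
    simp [hl] at hz

/-- A step changes the parent of a node only from a stable node to a stable node. -/
theorem Step.parent_eq_or_stable (hstep : Step α C C' A) (v : V) :
    C'.parent v = C.parent v ∨
      ∃ a b, C.Stable a ∧ C.Stable b ∧ C.parent v = some a ∧ C'.parent v = some b := by
  by_cases hv : ∀ u ∈ A, SwapEnabled α C u →
      v ≠ C.minChild u ∧ v ≠ C.maxChild (C.maxChild u)
  · exact .inl (hstep.parent_keep v hv)
  right
  push Not at hv
  obtain ⟨u, huA, hu, hv⟩ := hv
  by_cases hmin : v = C.minChild u
  · subst hmin
    exact ⟨u, C.maxChild u, hu.1, hu.2.1, mem_children.mp (minChild_mem hu.not_isLeaf),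
      hstep.swap_out u huA hu⟩
  · obtain rfl := hv hmin
    by_cases hl : C.IsLeaf (C.maxChild u)
    · refine ⟨u, u, hu.1, hu.1, ?_, hstep.swap_in u huA hu⟩
      rw [maxChild_of_isLeaf hl]
      exact mem_children.mp (maxChild_mem hu.not_isLeaf)
    · exact ⟨C.maxChild u, u, hu.2.1, hu.1, mem_children.mp (maxChild_mem hl),
        hstep.swap_in u huA hu⟩

theorem Step.parent_eq_some_iff (hstep : Step α C C' A) {u : V} (hu : ¬ C.Stable u) (v : V) :
    C'.parent v = some u ↔ C.parent v = some u := by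
  obtain h | ⟨a, b, ha, hb, hpa, hpb⟩ := hstep.parent_eq_or_stable v
  · rw [h]
  · rw [hpa, hpb, Option.some_inj, Option.some_inj]
    exact iff_of_false (fun h => hu (h ▸ hb)) (fun h => hu (h ▸ ha))

theorem Step.children_eq (hstep : Step α C C' A) {u : V} (hu : ¬ C.Stable u) :
    C'.children u = C.children u := by
  ext v
  rw [mem_children, mem_children, hstep.parent_eq_some_iff hu]

theorem newHeight_le_of_not_bad {v : V} (hv : ¬ C.Bad v) : C.newHeight v ≤ C.height v := by
  by_cases hl : C.IsLeaf v <;> simp [Bad, newHeight, hl] at hv ⊢ <;> omega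

/-- The height of a node does not increase in a step unless the node is an activated bad node. -/
theorem Step.height_le (hstep : Step α C C' A) {v : V}
    (hv : ¬ (v ∈ A ∧ C.Bad v ∧ C.UpdateEnabled v)) : C'.height v ≤ C.height v := by
  by_cases h : v ∈ A ∧ C.UpdateEnabled v
  · rw [hstep.height_update v h.1 h.2]
    exact newHeight_le_of_not_bad fun hb => hv ⟨h.1, hb, h.2⟩
  · exact (hstep.height_keep v h).le

/-- A node performing a height update is not bad afterwards if the heights of its children
do not increase. -/
theorem Step.not_bad (hstep : Step α C C' A) {u : V} (huA : u ∈ A) (hu : C.UpdateEnabled u)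
    (h : ∀ v ∈ C.children u, C'.height v ≤ C.height v) : ¬ C'.Bad u := by
  have hc := hstep.children_eq hu
  have hl : C'.IsLeaf u ↔ C.IsLeaf u := by rw [IsLeaf, IsLeaf, hc]
  rw [Bad, hl, hstep.height_update u huA hu, newHeight]
  by_cases hlu : C.IsLeaf u
  · simp [hlu]
  · have : C'.maxH u ≤ C.maxH u := maxH_le (mt hl.mp hlu) fun v hv => by
      rw [hc] at hv
      exact (h v hv).trans (height_le_maxH hv)
    simp only [hlu, not_false_eq_true, true_and, if_false, false_and, or_false]
    omega

end

end PreConfig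

/-- Let `C →_A C'` be an execution step and `E` a weakly connected
component of `G(A_b)`, the subgraph induced in `C` by the set `A_b` of activated bad
nodes performing a height update. Then in `C'` the nodes of `E` induce a weakly
connected subgraph identical to `E` (the edges between nodes of `E` are unchanged),
and no leaf of `E` (node of `E` with no child in `E`) is a bad node of `C'`. -/
theorem stmt10 {V : Type*} [Fintype V] [LinearOrder V] (α : ℤ) (hα : 1 ≤ α)
    (C C' : PreConfig V) (A : Finset V) (r : V)
    (hT : C.IsTree r) (hstep : PreConfig.Step α C C' A)
    (Ab : Set V) (hAb : Ab = {u | u ∈ A ∧ C.Bad u ∧ C.UpdateEnabled u})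
    (E : Set V) (x : V) (hx : x ∈ Ab)
    (hE : E = {y | Relation.ReflTransGen
      (fun p q => p ∈ Ab ∧ q ∈ Ab ∧ (C.parent p = some q ∨ C.parent q = some p)) x y}) :
    (∀ p ∈ E, ∀ q ∈ E, (C'.parent p = some q ↔ C.parent p = some q)) ∧
    (∀ u ∈ E, (∀ v ∈ E, C.parent v ≠ some u) → ¬ C'.Bad u) := by
  have hEAb : ∀ y ∈ E, y ∈ Ab := by
    intro y hy
    rw [hE] at hy
    obtain rfl | ⟨_, _, h⟩ := Relation.ReflTransGen.cases_tail hy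
    · exact hx
    · exact h.2.1
  have hAb' : ∀ y, y ∈ Ab ↔ y ∈ A ∧ C.Bad y ∧ C.UpdateEnabled y := fun y => by rw [hAb]; rfl
  refine ⟨fun p _ q hq => hstep.parent_eq_some_iff ((hAb' q).mp (hEAb q hq)).2.2 p, ?_⟩
  intro u hu hleaf
  have huAb := (hAb' u).mp (hEAb u hu)
  refine hstep.not_bad huAb.1 huAb.2.2 fun v hv => hstep.height_le fun hbad => ?_
  have hvu := PreConfig.mem_children.mp hv
  refine hleaf v ?_ hvu
  rw [hE] at hu ⊢
  exact Relation.ReflTransGen.tail hu ⟨(hAb' u).mpr huAb, (hAb' v).mpr hbad, .inr hvu⟩
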